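/- arXiv:2312.14374 — 2 statements merged into one kernel-verified Lean document; each statement's English description precedes it below -/
import Mathlib

section
/- Let θ be a substitution whose domain contains no variable occurring in any of the terms t₁, …, tₙ. If θ unifies a unification problem U, then ρ(θ) unifies ρ(U). -/
inductive FOTerm (F : Type) (V : Type) : Type where
  | var : V → FOTerm F V
  | app : F → List (FOTerm F V) → FOTerm F V

namespace FOTerm

variable {F V : Type}

/-- Application of a substitution to a term. -/
def subst (θ : V → FOTerm F V) : FOTerm F V → FOTerm F V
  | .var x => θ x
  | .app f ts => .app f (ts.attach.map fun ⟨t, _⟩ => subst θ t)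

/-- Replacement `ρ`: replace every occurrence of the nullary symbol `u` by `c(tl)`. -/
def replace [DecidableEq F] (u c : F) (tl : List (FOTerm F V)) : FOTerm F V → FOTerm F V
  | .var x => .var x
  | .app f [] => if f = u then .app c tl else .app f []
  | .app f ts => .app f (ts.attach.map fun ⟨t, _⟩ => replace u c tl t)

/-- Inversion `ι`: replace every outermost subterm headed by `c` by the constant `u`. -/
def invert [DecidableEq F] (u c : F) : FOTerm F V → FOTerm F V
  | .var x => .var x
  | .app f ts => if f = c then .app u [] else .app f (ts.attach.map fun ⟨t, _⟩ => invert u c t)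

/-- The variable `x` occurs in a term. -/
inductive OccursVar (x : V) : FOTerm F V → Prop
  | var : OccursVar x (.var x)
  | app {f : F} {ts : List (FOTerm F V)} {t : FOTerm F V} :
      t ∈ ts → OccursVar x t → OccursVar x (.app f ts)

/-- The function symbol `g` occurs (as head of some subterm) in a term. -/
inductive OccursFn (g : F) : FOTerm F V → Prop
  | head {ts : List (FOTerm F V)} : OccursFn g (.app g ts)
  | arg {f : F} {ts : List (FOTerm F V)} {t : FOTerm F V} :
      t ∈ ts → OccursFn g t → OccursFn g (.app f ts)

/-- The domain of a substitution: the variables it moves. -/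
def domain (θ : V → FOTerm F V) : Set V := {x | θ x ≠ FOTerm.var x}

/-- A substitution is a map from variables to terms moving only finitely many variables. -/
def IsSubst (θ : V → FOTerm F V) : Prop := (domain θ).Finite

/-- `ρ` extended to substitutions. -/
def replaceSubst [DecidableEq F] (u c : F) (tl : List (FOTerm F V))
    (θ : V → FOTerm F V) : V → FOTerm F V := fun x => replace u c tl (θ x)

/-- `ι` extended to substitutions. -/
def invertSubst [DecidableEq F] (u c : F) (θ : V → FOTerm F V) : V → FOTerm F V :=
  fun x => invert u c (θ x)

/-- Apply a term transformation to both components of every pair of a unification problem. -/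
def mapProb (g : FOTerm F V → FOTerm F V) (U : Set (FOTerm F V × FOTerm F V)) :
    Set (FOTerm F V × FOTerm F V) := (fun p => (g p.1, g p.2)) '' U

/-- `θ` unifies the unification problem `U`. -/
def Unifies (θ : V → FOTerm F V) (U : Set (FOTerm F V × FOTerm F V)) : Prop :=
  ∀ p ∈ U, subst θ p.1 = subst θ p.2

/-- `U` is unifiable. -/
def Unifiable (U : Set (FOTerm F V × FOTerm F V)) : Prop :=
  ∃ θ, IsSubst θ ∧ Unifies θ U

end FOTerm

namespace FOTerm

variable {F V : Type}

/-- A substitution fixing every variable that occurs in a term fixes the term. -/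
theorem subst_eq_self (θ : V → FOTerm F V) :
    ∀ s : FOTerm F V, (∀ x, OccursVar x s → θ x = .var x) → subst θ s = s
  | .var x, h => by rw [subst]; exact h x .var
  | .app f ts, h => by
    rw [subst]
    congr 1
    refine (List.map_congr_left fun ⟨t, ht⟩ _ => ?_).trans ts.attach_map_subtype_val
    exact subst_eq_self θ t fun x hx => h x (.app ht hx)

/-- Replacement commutes with applying a substitution that fixes the variables of `tl`. -/
theorem subst_replaceSubst_replace [DecidableEq F] (u c : F) (tl : List (FOTerm F V))
    (θ : V → FOTerm F V) (h : ∀ t ∈ tl, ∀ x, OccursVar x t → θ x = .var x) :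
    ∀ s : FOTerm F V,
      subst (replaceSubst u c tl θ) (replace u c tl s) = replace u c tl (subst θ s)
  | .var x => by simp only [replace, subst, replaceSubst]
  | .app f [] => by
    by_cases hf : f = u
    · have hfix : subst (replaceSubst u c tl θ) (.app c tl) = .app c tl := by
        refine subst_eq_self _ _ fun x hx => ?_
        cases hx with
        | app ht hx => rw [replaceSubst, h _ ht x hx, replace]
      simpa [replace, subst, hf] using hfix
    · simp [replace, subst, hf]
  | .app f (t :: ts) => by
    have ih : ∀ s ∈ t :: ts,
        subst (replaceSubst u c tl θ) (replace u c tl s) = replace u c tl (subst θ s) :=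
      fun s _ => subst_replaceSubst_replace u c tl θ h s
    simpa [replace, subst] using ih

end FOTerm

/-- Let `θ` be a substitution whose domain contains no variable
occurring in any of the terms `t₁, …, tₙ` (the list `tl`).  If `θ` unifies a
unification problem `U`, then `ρ(θ)` unifies `ρ(U)`. -/
theorem replaceSubst_unifies {F V : Type} [DecidableEq F]
    (u c : F) (tl : List (FOTerm F V)) (θ : V → FOTerm F V)
    (hθ : FOTerm.IsSubst θ)
    (hdom : ∀ x ∈ FOTerm.domain θ, ∀ t ∈ tl, ¬ FOTerm.OccursVar x t)
    (U : Set (FOTerm F V × FOTerm F V)) (hU : U.Finite)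
    (hunif : FOTerm.Unifies θ U) :
    FOTerm.Unifies (FOTerm.replaceSubst u c tl θ)
      (FOTerm.mapProb (FOTerm.replace u c tl) U) := by
  rintro _ ⟨p, hp, rfl⟩
  have hfix : ∀ t ∈ tl, ∀ x, FOTerm.OccursVar x t → θ x = .var x :=
    fun t ht x hx => by_contra fun hne => hdom x hne t ht hx
  simp only [FOTerm.subst_replaceSubst_replace u c tl θ hfix, hunif p hp]
end

section
/- Let U be a unification problem such that the symbol c does not occur in any term of U and no variable occurring in t₁, …, tₙ occurs in any term of U. If a single Martelli–Montanari transformation step transforms U into a unification problem U'', then there is a finite nonempty sequence of Martelli–Montanari transformation steps transforming ρ(U) into ρ(U''). -/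
/-- The substitution sending the variable `x` to the term `s` (and every other
variable to itself). -/
def FOTerm.single {F V : Type} [DecidableEq V] (x : V) (s : FOTerm F V) :
    V → FOTerm F V := fun y => if y = x then s else FOTerm.var y

/-- A single Martelli–Montanari transformation step on a unification problem. -/
inductive FOTerm.MMStep {F V : Type} [DecidableEq V] :
    Set (FOTerm F V × FOTerm F V) → Set (FOTerm F V × FOTerm F V) → Prop
  /-- (reorder) replace a pair `⟨s, x⟩`, where `s` is not a variable and `x` is a
  variable, by `⟨x, s⟩`. -/
  | reorder {U : Set (FOTerm F V × FOTerm F V)} {s : FOTerm F V} {x : V}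
      (hs : ∀ y : V, s ≠ FOTerm.var y) (h : (s, FOTerm.var x) ∈ U) :
      FOTerm.MMStep U ((U \ {(s, FOTerm.var x)}) ∪ {(FOTerm.var x, s)})
  /-- (drop trivial) delete a pair `⟨x, x⟩` with `x` a variable. -/
  | dropTrivial {U : Set (FOTerm F V × FOTerm F V)} {x : V}
      (h : (FOTerm.var x, FOTerm.var x) ∈ U) :
      FOTerm.MMStep U (U \ {(FOTerm.var x, FOTerm.var x)})
  /-- (variable elimination) given a pair `⟨x, s⟩` with `x` a variable, `s ≠ x`,
  `x` not occurring in `s`, and `x` occurring in some other pair of the problem,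
  apply the substitution sending `x` to `s` to the whole problem. -/
  | varElim {U : Set (FOTerm F V × FOTerm F V)} {x : V} {s : FOTerm F V}
      (h : (FOTerm.var x, s) ∈ U) (hne : s ≠ FOTerm.var x)
      (hocc : ¬ FOTerm.OccursVar x s)
      (helse : ∃ q ∈ U, q ≠ (FOTerm.var x, s) ∧
        (FOTerm.OccursVar x q.1 ∨ FOTerm.OccursVar x q.2)) :
      FOTerm.MMStep U (FOTerm.mapProb (FOTerm.subst (FOTerm.single x s)) U)
  /-- (term reduction) replace a pair whose two components have the same head
  symbol `f` (and the same number of arguments) by the pairs of corresponding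
  arguments. -/
  | termRed {U : Set (FOTerm F V × FOTerm F V)} {f : F}
      {ts₁ ts₂ : List (FOTerm F V)}
      (h : (FOTerm.app f ts₁, FOTerm.app f ts₂) ∈ U)
      (hlen : ts₁.length = ts₂.length) :
      FOTerm.MMStep U ((U \ {(FOTerm.app f ts₁, FOTerm.app f ts₂)}) ∪
        {p | p ∈ ts₁.zip ts₂})

namespace FOTerm

variable {F V : Type}

theorem induction_mem {P : FOTerm F V → Prop} (var : ∀ x, P (.var x))
    (app : ∀ f ts, (∀ t ∈ ts, P t) → P (.app f ts)) : ∀ t, P t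
  | .var x => var x
  | .app f ts => app f ts fun t _ => induction_mem var app t

theorem subst_app (θ : V → FOTerm F V) (f : F) (ts : List (FOTerm F V)) :
    subst θ (.app f ts) = .app f (ts.map (subst θ)) := by
  simp [subst]

theorem occursVar_var_iff {x y : V} : OccursVar x (.var y : FOTerm F V) ↔ x = y := by
  constructor
  · rintro ⟨⟩
    rfl
  · rintro rfl
    exact .var

theorem occursVar_app_iff {x : V} {f : F} {ts : List (FOTerm F V)} :
    OccursVar x (.app f ts) ↔ ∃ t ∈ ts, OccursVar x t := by
  constructor
  · rintro (_ | ⟨ht, h⟩)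
    exact ⟨_, ht, h⟩
  · rintro ⟨t, ht, h⟩
    exact .app ht h

theorem subst_single_of_not_occursVar [DecidableEq V] {x : V} {s : FOTerm F V} (t : FOTerm F V) :
    ¬ OccursVar x t → subst (single x s) t = t := by
  induction t using induction_mem with
  | var y =>
    intro h
    rw [occursVar_var_iff] at h
    simp [subst, single, Ne.symm h]
  | app f ts ih =>
    intro h
    rw [subst_app, List.map_congr_left (g := id) fun t ht => ih t ht fun hx => h (.app ht hx),
      List.map_id]

theorem mapProb_mapProb (g h : FOTerm F V → FOTerm F V) (U : Set (FOTerm F V × FOTerm F V)) :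
    mapProb g (mapProb h U) = mapProb (g ∘ h) U := by
  simp [mapProb, Set.image_image]

theorem mapProb_union (g : FOTerm F V → FOTerm F V) (U W : Set (FOTerm F V × FOTerm F V)) :
    mapProb g (U ∪ W) = mapProb g U ∪ mapProb g W :=
  Set.image_union ..

theorem mapProb_singleton (g : FOTerm F V → FOTerm F V) (s t : FOTerm F V) :
    mapProb g {(s, t)} = {(g s, g t)} :=
  Set.image_singleton

theorem mapProb_zip (g : FOTerm F V → FOTerm F V) (ts₁ ts₂ : List (FOTerm F V)) :
    mapProb g {p | p ∈ ts₁.zip ts₂} = {p | p ∈ (ts₁.map g).zip (ts₂.map g)} := by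
  ext p
  simp [mapProb, List.zip_map, Prod.map]

section Replace

variable [DecidableEq F] {u c : F} {tl : List (FOTerm F V)}

theorem replace_var (x : V) : replace u c tl (.var x : FOTerm F V) = .var x := by
  simp [replace]

theorem replace_unknown : replace u c tl (.app u [] : FOTerm F V) = .app c tl := by
  simp [replace]

theorem replace_app {f : F} {ts : List (FOTerm F V)} (h : ¬ (f = u ∧ ts = [])) :
    replace u c tl (.app f ts) = .app f (ts.map (replace u c tl)) := by
  cases ts with
  | nil => simp_all [replace]
  | cons t ts => simp [replace]

theorem replace_app_ne_var (f : F) (ts : List (FOTerm F V)) (x : V) :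
    replace u c tl (.app f ts) ≠ .var x := by
  by_cases h : f = u ∧ ts = []
  · obtain ⟨rfl, rfl⟩ := h
    simp [replace_unknown]
  · simp [replace_app h]

theorem replace_ne_var {s : FOTerm F V} {x : V} (h : s ≠ .var x) :
    replace u c tl s ≠ .var x := by
  cases s with
  | var y => rwa [replace_var]
  | app f ts => exact replace_app_ne_var f ts x

/-- `replace` is injective on terms in which `c` does not occur. -/
theorem replace_inj (s : FOTerm F V) : ∀ t : FOTerm F V, ¬ OccursFn c s → ¬ OccursFn c t →
    replace u c tl s = replace u c tl t → s = t := by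
  induction s using induction_mem with
  | var x =>
    intro t _ _ h
    by_contra hne
    rw [replace_var] at h
    exact replace_ne_var (Ne.symm hne) h.symm
  | app f ts ih =>
    rintro (y | ⟨g, ss⟩) hs ht h
    · exact absurd (h.trans (replace_var y)) (replace_app_ne_var f ts y)
    have hf : f ≠ c := by
      rintro rfl
      exact hs .head
    have hg : g ≠ c := by
      rintro rfl
      exact ht .head
    by_cases h₁ : f = u ∧ ts = [] <;> by_cases h₂ : g = u ∧ ss = []
    · rw [h₁.1, h₁.2, h₂.1, h₂.2]
    · rw [h₁.1, h₁.2, replace_unknown, replace_app h₂, app.injEq] at h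
      exact absurd h.1.symm hg
    · rw [h₂.1, h₂.2, replace_unknown, replace_app h₁, app.injEq] at h
      exact absurd h.1 hf
    · rw [replace_app h₁, replace_app h₂, app.injEq] at h
      obtain ⟨rfl, h⟩ := h
      congr 1
      have hlen : ts.length = ss.length := by simpa using congrArg List.length h
      refine List.ext_getElem hlen fun i hi hj => ih _ (List.getElem_mem hi) _
        (fun ho => hs (.arg (List.getElem_mem hi) ho))
        (fun ho => ht (.arg (List.getElem_mem hj) ho)) ?_
      simpa [hi, hj] using congrArg (fun l => l[i]?) h

theorem occursVar_replace {x : V} {s : FOTerm F V} (h : OccursVar x s) :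
    OccursVar x (replace u c tl s) := by
  induction h with
  | var => rw [replace_var]; exact .var
  | app ht _ ih =>
    rw [replace_app fun hnil => List.ne_nil_of_mem ht hnil.2]
    exact .app (List.mem_map_of_mem ht) ih

theorem occursVar_of_occursVar_replace {x : V} (hx : ∀ t ∈ tl, ¬ OccursVar x t)
    (s : FOTerm F V) : OccursVar x (replace u c tl s) → OccursVar x s := by
  induction s using induction_mem with
  | var y => rw [replace_var]; exact id
  | app f ts ih =>
    by_cases h : f = u ∧ ts = []
    · obtain ⟨rfl, rfl⟩ := h
      rw [replace_unknown, occursVar_app_iff]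
      rintro ⟨t, ht, ho⟩
      exact absurd ho (hx t ht)
    · rw [replace_app h, occursVar_app_iff]
      simp only [List.mem_map, exists_exists_and_eq_and]
      rintro ⟨t, ht, ho⟩
      exact .app ht (ih t ht ho)

theorem replace_subst_single [DecidableEq V] {x : V} (hx : ∀ t ∈ tl, ¬ OccursVar x t)
    (s t : FOTerm F V) :
    replace u c tl (subst (single x s) t) =
      subst (single x (replace u c tl s)) (replace u c tl t) := by
  induction t using induction_mem with
  | var y =>
    by_cases h : y = x <;> simp [replace_var, subst, single, h]
  | app f ts ih =>
    by_cases h : f = u ∧ ts = []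
    · obtain ⟨rfl, rfl⟩ := h
      rw [subst_app, List.map_nil, replace_unknown, subst_single_of_not_occursVar]
      rw [occursVar_app_iff]
      rintro ⟨t, ht, ho⟩
      exact hx t ht ho
    · rw [subst_app, replace_app (by simpa using h), replace_app h, subst_app]
      simpa using ih

theorem mapProb_replace_diff_singleton {U : Set (FOTerm F V × FOTerm F V)}
    (hc : ∀ p ∈ U, ¬ OccursFn c p.1 ∧ ¬ OccursFn c p.2) {s t : FOTerm F V} (h : (s, t) ∈ U) :
    mapProb (replace u c tl) (U \ {(s, t)}) =
      mapProb (replace u c tl) U \ {(replace u c tl s, replace u c tl t)} := by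
  have hinj : Set.InjOn (fun p => (replace u c tl p.1, replace u c tl p.2)) U := by
    intro p hp q hq hpq
    rw [Prod.mk.injEq] at hpq
    exact Prod.ext (replace_inj _ _ (hc p hp).1 (hc q hq).1 hpq.1)
      (replace_inj _ _ (hc p hp).2 (hc q hq).2 hpq.2)
  rw [mapProb, hinj.image_sdiff_subset (Set.singleton_subset_iff.2 h), Set.image_singleton]
  rfl

end Replace

theorem reach_union_diag [DecidableEq V] {ts : List (FOTerm F V)}
    (h : ∀ t ∈ ts, ∀ W, Relation.ReflTransGen MMStep (insert (t, t) W) W)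
    (W : Set (FOTerm F V × FOTerm F V)) :
    Relation.ReflTransGen MMStep (W ∪ {p | p ∈ ts.zip ts}) W := by
  induction ts with
  | nil => simp [Relation.ReflTransGen.refl]
  | cons t ts ih =>
    have heq : W ∪ {p | p ∈ (t :: ts).zip (t :: ts)} =
        insert (t, t) (W ∪ {p | p ∈ ts.zip ts}) := by
      ext p
      simp only [List.zip_cons_cons, List.mem_cons, Set.mem_union, Set.mem_ofPred_eq,
        Set.mem_insert_iff]
      tauto
    rw [heq]
    exact (h t List.mem_cons_self _).trans (ih fun t ht => h t (List.mem_cons_of_mem _ ht))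

/-- A pair of identical terms can be deleted by Martelli–Montanari steps. -/
theorem reach_insert_diag [DecidableEq V] (t : FOTerm F V) :
    ∀ W, Relation.ReflTransGen MMStep (insert (t, t) W) W := by
  induction t using induction_mem with
  | var x =>
    intro W
    by_cases h : ((.var x, .var x) : FOTerm F V × FOTerm F V) ∈ W
    · rw [Set.insert_eq_of_mem h]
    · have hstep := MMStep.dropTrivial (Set.mem_insert ((.var x, .var x) : FOTerm F V × _) W)
      rw [Set.insert_sdiff_self_of_notMem h] at hstep
      exact .single hstep
  | app f ts ih =>
    intro W
    by_cases h : (FOTerm.app f ts, FOTerm.app f ts) ∈ W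
    · rw [Set.insert_eq_of_mem h]
    · have hstep := MMStep.termRed (Set.mem_insert (FOTerm.app f ts, FOTerm.app f ts) W) rfl
      rw [Set.insert_sdiff_self_of_notMem h] at hstep
      exact .head hstep (reach_union_diag ih W)

end FOTerm

/-- Let `U` be a unification problem in which the symbol `c`
does not occur and in which no variable occurring in `t₁, …, tₙ` (the list `tl`)
occurs.  If a single Martelli–Montanari step transforms `U` into `U''`, then a
finite nonempty sequence of Martelli–Montanari steps transforms `ρ(U)` into
`ρ(U'')`. -/
theorem mmStep_replace {F V : Type} [DecidableEq F] [DecidableEq V]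
    (u c : F) (tl : List (FOTerm F V))
    (U U'' : Set (FOTerm F V × FOTerm F V)) (hU : U.Finite)
    (hc : ∀ p ∈ U, ¬ FOTerm.OccursFn c p.1 ∧ ¬ FOTerm.OccursFn c p.2)
    (hvars : ∀ x : V, (∃ t ∈ tl, FOTerm.OccursVar x t) →
      ∀ p ∈ U, ¬ FOTerm.OccursVar x p.1 ∧ ¬ FOTerm.OccursVar x p.2)
    (hstep : FOTerm.MMStep U U'') :
    Relation.TransGen FOTerm.MMStep
      (FOTerm.mapProb (FOTerm.replace u c tl) U)
      (FOTerm.mapProb (FOTerm.replace u c tl) U'') := by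
  cases hstep with
  | @reorder s x hs h =>
    rw [FOTerm.mapProb_union, FOTerm.mapProb_replace_diff_singleton hc h,
      FOTerm.mapProb_singleton, FOTerm.replace_var]
    refine .single (.reorder (fun y => FOTerm.replace_ne_var (hs y)) ?_)
    exact ⟨_, h, by simp [FOTerm.replace_var]⟩
  | @dropTrivial x h =>
    rw [FOTerm.mapProb_replace_diff_singleton hc h, FOTerm.replace_var]
    exact .single (.dropTrivial ⟨_, h, by simp [FOTerm.replace_var]⟩)
  | @varElim x s h hne hocc helse =>
    have hx : ∀ t ∈ tl, ¬ FOTerm.OccursVar x t := fun t ht ho =>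
      (hvars x ⟨t, ht, ho⟩ _ h).1 .var
    have hcomp : FOTerm.replace u c tl ∘ FOTerm.subst (FOTerm.single x s) =
        FOTerm.subst (FOTerm.single x (FOTerm.replace u c tl s)) ∘ FOTerm.replace u c tl :=
      funext (FOTerm.replace_subst_single hx s)
    rw [FOTerm.mapProb_mapProb, hcomp, ← FOTerm.mapProb_mapProb]
    obtain ⟨q, hq, hqne, hqocc⟩ := helse
    refine .single (.varElim ⟨_, h, by simp [FOTerm.replace_var]⟩ (FOTerm.replace_ne_var hne)
      (fun ho => hocc (FOTerm.occursVar_of_occursVar_replace hx s ho))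
      ⟨_, ⟨q, hq, rfl⟩, fun heq => hqne ?_,
        hqocc.imp FOTerm.occursVar_replace FOTerm.occursVar_replace⟩)
    rw [← FOTerm.replace_var (u := u) (c := c) (tl := tl) x, Prod.mk.injEq] at heq
    exact Prod.ext (FOTerm.replace_inj _ _ (hc q hq).1 (hc _ h).1 heq.1)
      (FOTerm.replace_inj _ _ (hc q hq).2 (hc _ h).2 heq.2)
  | @termRed f ts₁ ts₂ h hlen =>
    rw [FOTerm.mapProb_union, FOTerm.mapProb_replace_diff_singleton hc h, FOTerm.mapProb_zip]
    have hmem : (FOTerm.replace u c tl (.app f ts₁), FOTerm.replace u c tl (.app f ts₂)) ∈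
        FOTerm.mapProb (FOTerm.replace u c tl) U := ⟨_, h, rfl⟩
    by_cases h₁ : f = u ∧ ts₁ = []
    · obtain ⟨rfl, rfl⟩ := h₁
      obtain rfl : ts₂ = [] := List.length_eq_zero_iff.1 hlen.symm
      rw [FOTerm.replace_unknown] at hmem ⊢
      refine .head' (.termRed hmem rfl) ?_
      simpa using FOTerm.reach_union_diag (fun t _ => FOTerm.reach_insert_diag t) _
    · have h₂ : ¬ (f = u ∧ ts₂ = []) := by
        rintro ⟨rfl, rfl⟩
        exact h₁ ⟨rfl, List.length_eq_zero_iff.1 hlen⟩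
      rw [FOTerm.replace_app h₁, FOTerm.replace_app h₂] at hmem ⊢
      exact .single (.termRed hmem (by simpa using hlen))
end
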